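/- Let k ≥ 1 and let G be a finite nonempty connected P5-free simple graph whose largest clique has at most k vertices. Then G has a dominating set D such that |D| ≤ max{k,3} and the subgraph of G induced on D is connected. -/

import Mathlib

/-- A simple graph is `P5`-free if it contains no induced path on 5 vertices. -/
def IsP5Free {V : Type*} (G : SimpleGraph V) : Prop :=
  ¬ ∃ p : Fin 5 → V, Function.Injective p ∧
    ∀ i j : Fin 5, G.Adj (p i) (p j) ↔ (j.val = i.val + 1 ∨ i.val = j.val + 1)

/-- `D` is a dominating set of `G`: every vertex is in `D` or has a neighbor in `D`. -/
def IsDomSet {V : Type*} (G : SimpleGraph V) (D : Set V) : Prop :=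
  ∀ v : V, v ∈ D ∨ ∃ d ∈ D, G.Adj v d

theorem p5_false {V : Type*} {G : SimpleGraph V} (h : IsP5Free G) {a b c d e : V}
    (ab : G.Adj a b) (bc : G.Adj b c) (cd : G.Adj c d) (de : G.Adj d e)
    (ac : ¬ G.Adj a c) (ad : ¬ G.Adj a d) (ae : ¬ G.Adj a e)
    (bd : ¬ G.Adj b d) (be : ¬ G.Adj b e) (ce : ¬ G.Adj c e) : False := by
  have n1 : a ≠ b := ab.ne
  have n2 : b ≠ c := bc.ne
  have n3 : c ≠ d := cd.ne
  have n4 : d ≠ e := de.ne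
  have n5 : a ≠ c := by rintro rfl; exact ad cd
  have n6 : a ≠ d := by rintro rfl; exact ae de
  have n7 : a ≠ e := by rintro rfl; exact ad de.symm
  have n8 : b ≠ d := by rintro rfl; exact be de
  have n9 : b ≠ e := by rintro rfl; exact ae ab
  have n10 : c ≠ e := by rintro rfl; exact be bc
  apply h
  refine ⟨![a, b, c, d, e], ?_, ?_⟩
  · intro i j hij
    fin_cases i <;> fin_cases j <;> simp_all
  · intro i j
    have := ab.symm
    have := bc.symm
    have := cd.symm
    have := de.symm
    have : ¬ G.Adj c a := fun hh => ac hh.symm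
    have : ¬ G.Adj d a := fun hh => ad hh.symm
    have : ¬ G.Adj e a := fun hh => ae hh.symm
    have : ¬ G.Adj d b := fun hh => bd hh.symm
    have : ¬ G.Adj e b := fun hh => be hh.symm
    have : ¬ G.Adj e c := fun hh => ce hh.symm
    fin_cases i <;> fin_cases j <;> simp_all

/-- Dominating clique, or a dominating (not necessarily induced) path on three vertices. -/
def CliqueOrPath {V : Type*} (G : SimpleGraph V) : Prop :=
  (∃ K : Set V, K.Nonempty ∧ G.IsClique K ∧ ∀ x, x ∈ K ∨ ∃ d ∈ K, G.Adj x d) ∨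
  ∃ a b c, G.Adj a b ∧ G.Adj b c ∧
    ∀ x, x = a ∨ x = b ∨ x = c ∨ G.Adj x a ∨ G.Adj x b ∨ G.Adj x c

theorem clique_case {V : Type*} {G : SimpleGraph V} (h : IsP5Free G) {v u : V}
    (hvu : G.Adj v u) (K : Set V) (hK : K.Nonempty) (hcl : G.IsClique K)
    (hd : ∀ x, x ≠ v → x ∈ K ∨ ∃ d ∈ K, G.Adj x d) : CliqueOrPath G := by
  by_cases hv : ∃ d ∈ K, G.Adj v d
  · left
    refine ⟨K, hK, hcl, fun x => ?_⟩
    by_cases hx : x = v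
    · subst hx; exact Or.inr hv
    · exact hd x hx
  push Not at hv
  have huK : u ∉ K := fun hu => hv u hu hvu
  obtain ⟨s, hsK, hus⟩ := (hd u hvu.ne').resolve_left huK
  by_cases hz : ∃ z, z ≠ v ∧ z ≠ u ∧ ¬ G.Adj z u ∧ ∀ d ∈ K, G.Adj u d → ¬ G.Adj z d ∧ z ≠ d
  · obtain ⟨z, hzv, hzu, hzu', hzS⟩ := hz
    have key : ∀ z, z ≠ v → z ≠ u → ¬ G.Adj z u →
        (∀ d ∈ K, G.Adj u d → ¬ G.Adj z d ∧ z ≠ d) → G.Adj v z := by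
      intro z hzv hzu hzu' hzS
      by_contra hvz
      have hzK : z ∉ K := fun hz => (hzS s hsK hus).1 (hcl hz hsK (hzS s hsK hus).2)
      obtain ⟨t, htK, hzt⟩ := (hd z hzv).resolve_left hzK
      have hut : ¬ G.Adj u t := fun hh => (hzS t htK hh).1 hzt
      have hst : G.Adj s t := hcl hsK htK (by rintro rfl; exact hut hus)
      exact p5_false h hvu hus hst hzt.symm (hv s hsK) (hv t htK) hvz hut
        (fun hh => hzu' hh.symm) (fun hh => (hzS s hsK hus).1 hh.symm)
    have hvz := key z hzv hzu hzu' hzS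
    right
    refine ⟨v, u, s, hvu, hus, ?_⟩
    intro w
    by_contra hw
    push Not at hw
    obtain ⟨w1, w2, w3, w4, w5, w6⟩ := hw
    have : ∃ s' ∈ K, G.Adj u s' ∧ (G.Adj w s' ∨ w = s') := by
      by_contra hno
      push Not at hno
      exact w4 (key w w1 w2 w5 hno).symm
    obtain ⟨s', hs'K, hus', hws'⟩ := this
    have hws : G.Adj w s' := by
      rcases hws' with h1 | rfl
      · exact h1
      · exact absurd hus'.symm w5
    by_cases hwz : G.Adj w z
    · exact p5_false h hwz hvz.symm hvu hus w4 w5 w6 hzu' (hzS s hsK hus).1 (hv s hsK)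
    · exact p5_false h hws hus'.symm hvu.symm hvz w5 w4 hwz (fun hh => hv s' hs'K hh.symm)
        (fun hh => (hzS s' hs'K hus').1 hh.symm) (fun hh => hzu' hh.symm)
  · push Not at hz
    left
    refine ⟨insert u {d | d ∈ K ∧ G.Adj u d}, ⟨u, by simp⟩, ?_, ?_⟩
    · rw [SimpleGraph.isClique_insert]
      exact ⟨hcl.subset (fun x hx => hx.1), fun b hb _ => hb.2⟩
    · intro x
      by_cases h1 : x = v
      · subst h1; exact Or.inr ⟨u, by simp, hvu⟩
      by_cases h2 : x = u
      · left; simp [h2]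
      by_cases h3 : G.Adj x u
      · exact Or.inr ⟨u, by simp, h3⟩
      obtain ⟨d, hdK, hud, hh⟩ := hz x h1 h2 h3
      by_cases h4 : G.Adj x d
      · exact Or.inr ⟨d, by simp [hdK, hud], h4⟩
      · have := hh h4
        subst this
        exact absurd hud.symm h3

theorem path_case {V : Type*} {G : SimpleGraph V} (h : IsP5Free G) {v u : V}
    (hvu : G.Adj v u) (a b c : V) (hab : G.Adj a b) (hbc : G.Adj b c)
    (hd : ∀ x, x ≠ v → x = a ∨ x = b ∨ x = c ∨ G.Adj x a ∨ G.Adj x b ∨ G.Adj x c) :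
    CliqueOrPath G := by
  by_cases hac : a = c
  · subst hac
    refine clique_case h hvu {a, b} (by simp) (by simp [SimpleGraph.isClique_pair, hab]) ?_
    intro x hx
    have := hd x hx
    simp
    tauto
  by_cases hac' : G.Adj a c
  · refine clique_case h hvu {a, b, c} (by simp) ?_ ?_
    · simp [SimpleGraph.isClique_insert, hab, hbc, hac']
    intro x hx
    have := hd x hx
    simp
    tauto
  have hca' : ¬ G.Adj c a := fun hh => hac' hh.symm
  by_cases hv : G.Adj v a ∨ G.Adj v b ∨ G.Adj v c
  · right
    refine ⟨a, b, c, hab, hbc, fun x => ?_⟩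
    by_cases hx : x = v
    · subst hx; tauto
    · exact hd x hx
  push Not at hv
  obtain ⟨va, vb, vc⟩ := hv
  have pth : ∀ p q r, G.Adj p q → G.Adj q r →
      (∀ x, x ≠ p → x ≠ q → x ≠ r → ¬ G.Adj x p → ¬ G.Adj x q → ¬ G.Adj x r → False) →
      CliqueOrPath G := by
    intro p q r h1 h2 h3
    right
    refine ⟨p, q, r, h1, h2, fun x => ?_⟩
    by_contra hx
    push Not at hx
    obtain ⟨a1, a2, a3, a4, a5, a6⟩ := hx
    exact h3 x a1 a2 a3 a4 a5 a6
  by_contra hno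
  have na : ∀ z, G.Adj v z → ¬ G.Adj z b → G.Adj z a → ¬ G.Adj z c → False :=
    fun z hz h1 h2 h3 => p5_false h hz h2 hab hbc va vb vc h1 h3 hac'
  have nc : ∀ z, G.Adj v z → ¬ G.Adj z b → G.Adj z c → ¬ G.Adj z a → False :=
    fun z hz h1 h2 h3 => p5_false h hz h2 hbc.symm hab.symm vc vb va h1 h3 hca'
  have nb : ∀ z, G.Adj v z → G.Adj z b → ¬ G.Adj z a → ¬ G.Adj z c → False := by
    intro z hz h1 h2 h3
    refine hno (pth v z b hz h1 ?_)
    intro x x1 x2 x3 x4 x5 x6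
    have hx := hd x x1
    by_cases xa : G.Adj x a
    · exact p5_false h hz h1 hab.symm xa.symm vb va (fun hh => x4 hh.symm) h2
        (fun hh => x5 hh.symm) (fun hh => x6 hh.symm)
    by_cases xc : G.Adj x c
    · exact p5_false h hz h1 hbc xc.symm vb vc (fun hh => x4 hh.symm) h3
        (fun hh => x5 hh.symm) (fun hh => x6 hh.symm)
    have := hbc.symm
    rcases hx with rfl | rfl | rfl | hx | hx | hx <;> tauto
  have vz : ∀ {z}, ¬ G.Adj z v → ¬ G.Adj v z := fun hh h2 => hh h2.symm
  have hu := hd u hvu.ne'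
  have hab' := hab.symm
  have hbc' := hbc.symm
  have hvu' := hvu.symm
  have sy : ∀ {x y}, G.Adj x y → G.Adj y x := fun hh => hh.symm
  have nsy : ∀ {x y}, ¬ G.Adj x y → ¬ G.Adj y x := fun hh h2 => hh h2.symm
  have onlyc : ∀ x, x ≠ v → x ≠ a → x ≠ b → ¬ G.Adj x a → ¬ G.Adj x b → G.Adj x c := by
    intro x h1 h2 h3 h4 h5
    rcases hd x h1 with rfl | rfl | rfl | hx | hx | hx <;> tauto
  have onlya : ∀ x, x ≠ v → x ≠ c → x ≠ b → ¬ G.Adj x c → ¬ G.Adj x b → G.Adj x a := by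
    intro x h1 h2 h3 h4 h5
    rcases hd x h1 with rfl | rfl | rfl | hx | hx | hx <;> tauto
  have ua : u ≠ a := by rintro rfl; exact va hvu
  have ub : u ≠ b := by rintro rfl; exact vb hvu
  have uc : u ≠ c := by rintro rfl; exact vc hvu
  have nv : ∀ {x}, ¬ G.Adj x u → x ≠ v := by rintro x hx rfl; exact hx hvu
  by_cases hub : G.Adj u b
  · by_cases hua : G.Adj u a
    · by_cases huc : G.Adj u c
      · have h1 : ∃ z, z ≠ a ∧ z ≠ b ∧ z ≠ u ∧ ¬ G.Adj z u ∧ ¬ G.Adj z b ∧ ¬ G.Adj z a := by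
          by_contra hh
          push Not at hh
          exact hno (pth u b a hub hab' (fun x x1 x2 x3 x4 x5 x6 => x6 (hh x x3 x2 x1 x4 x5)))
        have h2 : ∃ z, z ≠ c ∧ z ≠ b ∧ z ≠ u ∧ ¬ G.Adj z u ∧ ¬ G.Adj z b ∧ ¬ G.Adj z c := by
          by_contra hh
          push Not at hh
          exact hno (pth u b c hub hbc (fun x x1 x2 x3 x4 x5 x6 => x6 (hh x x3 x2 x1 x4 x5)))
        obtain ⟨z, z1, z2, z3, z4, z5, z6⟩ := h1
        obtain ⟨y, y1, y2, y3, y4, y5, y6⟩ := h2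
        have zc := onlyc z (nv z4) z1 z2 z6 z5
        have ya := onlya y (nv y4) y1 y2 y6 y5
        have vz' : ¬ G.Adj v z := fun hh => nc z hh z5 zc z6
        have vy' : ¬ G.Adj v y := fun hh => na y hh y5 ya y6
        by_cases hyz : G.Adj y z
        · exact p5_false h hvu huc zc.symm hyz.symm vc vz' vy' (nsy z4) (nsy y4) (nsy y6)
        · exact p5_false h ya hab hbc zc.symm y5 y6 hyz hac' (nsy z6) (nsy z5)
      · refine hno (pth u a b hua hab ?_)
        intro x x1 x2 x3 x4 x5 x6
        have xc := onlyc x (nv x4) x2 x3 x5 x6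
        exact p5_false h hvu hub hbc xc.symm vb vc (fun hh => nc x hh x6 xc x5) huc
          (nsy x4) (nsy x6)
    · by_cases huc : G.Adj u c
      · refine hno (pth u c b huc hbc' ?_)
        intro x x1 x2 x3 x4 x5 x6
        have xa := onlya x (nv x4) x2 x3 x5 x6
        exact p5_false h hvu hub hab' xa.symm vb va (fun hh => na x hh x6 xa x5) hua
          (nsy x4) (nsy x6)
      · exact nb u hvu hub hua huc
  · by_cases hua : G.Adj u a
    · by_cases huc : G.Adj u c
      · refine hno (pth a u c hua.symm huc ?_)
        intro x x1 x2 x3 x4 x5 x6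
        have xb : G.Adj x b := by
          have := nv x5
          rcases hd x (nv x5) with rfl | rfl | rfl | hx | hx | hx <;> tauto
        exact p5_false h hvu hua hab xb.symm va vb (fun hh => nb x hh xb x4 x6) hub
          (nsy x5) (nsy x4)
      · exact na u hvu hub hua huc
    · by_cases huc : G.Adj u c
      · exact nc u hvu hub huc hua
      · tauto

theorem cliqueOrPath_aux.{w} (n : ℕ) : ∀ (V : Type w) [Fintype V] (G : SimpleGraph V),
    Fintype.card V = n → G.Connected → IsP5Free G → CliqueOrPath G := by
  classical
  induction n with
  | zero =>
    intro V _ G hn hc _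
    have := hc.nonempty
    exact absurd hn Fintype.card_ne_zero
  | succ n ih =>
    intro V _ G hn hc hP
    rcases subsingleton_or_nontrivial V with hs | hnt
    · have := hc.nonempty
      left
      refine ⟨Set.univ, Set.univ_nonempty, ?_, by simp⟩
      intro x _ y _ hxy
      exact absurd (Subsingleton.elim x y) hxy
    obtain ⟨v, hv⟩ := hc.exists_connected_induce_compl_singleton_of_finite_nontrivial
    obtain ⟨u, hvu⟩ := hc.preconnected.exists_adj_of_nontrivial v
    have hP' : IsP5Free (G.induce ({v}ᶜ : Set V)) := by
      rintro ⟨p, hp, hq⟩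
      exact hP ⟨fun i => (p i : V), Subtype.val_injective.comp hp, fun i j => hq i j⟩
    have hcard : Fintype.card ({v}ᶜ : Set V) = n := by
      rw [Fintype.card_compl_set]; simp [hn]
    rcases ih _ (G.induce ({v}ᶜ : Set V)) hcard hv hP' with ⟨K, hK, hcl, hd⟩ | ⟨a, b, c, hab, hbc, hd⟩
    · refine clique_case hP hvu (Subtype.val '' K) (hK.image _) ?_ ?_
      · rintro _ ⟨x, hx, rfl⟩ _ ⟨y, hy, rfl⟩ hxy
        exact hcl hx hy (fun hh => hxy (congrArg _ hh))
      · intro x hx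
        rcases hd ⟨x, hx⟩ with h1 | ⟨d, h1, h2⟩
        · exact Or.inl ⟨_, h1, rfl⟩
        · exact Or.inr ⟨d, ⟨_, h1, rfl⟩, h2⟩
    · refine path_case hP hvu a b c hab hbc ?_
      intro x hx
      have := hd ⟨x, hx⟩
      simpa [Subtype.ext_iff] using this

theorem stmt1 {V : Type*} [Fintype V] (k : ℕ) (hk : 1 ≤ k)
    (G : SimpleGraph V) (hconn : G.Connected) (hP5 : IsP5Free G)
    (hclique : ∀ s : Finset V, G.IsClique (↑s : Set V) → s.card ≤ k) :
    ∃ D : Finset V, IsDomSet G ↑D ∧ D.card ≤ max k 3 ∧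
      (G.induce (↑D : Set V)).Connected := by
  classical
  rcases cliqueOrPath_aux _ V G rfl hconn hP5 with ⟨K, hK, hcl, hd⟩ | ⟨a, b, c, hab, hbc, hd⟩
  · refine ⟨K.toFinset, ?_, ?_, ?_⟩
    · intro x; simpa using hd x
    · exact le_max_of_le_left (hclique _ (by simpa using hcl))
    · rw [Set.coe_toFinset]
      have : Nonempty K := hK.to_subtype
      refine ⟨?_⟩
      intro x y
      by_cases hxy : x = y
      · subst hxy; exact SimpleGraph.Reachable.refl _
      · exact SimpleGraph.Adj.reachable (hcl x.2 y.2 (fun hh => hxy (Subtype.ext hh)))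
  · refine ⟨{a, b, c}, ?_, le_max_of_le_right Finset.card_le_three, ?_⟩
    · intro x
      have := hd x
      simp
      tauto
    · have key : ∀ x : ((({a, b, c} : Finset V) : Set V)),
          (G.induce ((({a, b, c} : Finset V) : Set V))).Reachable x ⟨b, by simp⟩ := by
        rintro ⟨x, hx⟩
        have hx' : x = a ∨ x = b ∨ x = c := by simpa using hx
        rcases hx' with rfl | rfl | rfl
        · exact SimpleGraph.Adj.reachable hab
        · exact SimpleGraph.Reachable.refl _
        · exact SimpleGraph.Adj.reachable hbc.symm
      have : Nonempty ((({a, b, c} : Finset V) : Set V)) := ⟨⟨b, by simp⟩⟩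
      exact ⟨fun x y => (key x).trans (key y).symm⟩
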